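/- Let U ⊆ ℝ^m be open and connected, let A₁, …, A_m : U → ℝ^{d×d} and Ω : U → ℝ^{d×d} be smooth matrix-valued functions, and let Γ = {γ₀, γ₁, …, γ_{t−1}} ⊂ ℤ_{≥0}^m be a finite set of multi-indices with γ₀ = 0. Suppose there exist continuous functions c_{ikl} : U → ℝ such that D_i(𝒟^{γ_k} Ω) = Σ_{l=0}^{t−1} c_{ikl} · 𝒟^{γ_l} Ω on U for all i ∈ {1, …, m} and k ∈ {0, …, t−1}. Let q_k, q_l : U → ℝ^d be smooth solutions of the Pfaffian system ∂_i q = A_i q on U, and fix z̄ ∈ U. Then q_k(z)ᵀ Ω(z) q_l(z) = 0 for all z ∈ U if and only if q_k(z̄)ᵀ (𝒟^γ Ω)(z̄) q_l(z̄) = 0 for every γ ∈ Γ; in particular, the infinitely many conditions q_k(z̄)ᵀ (𝒟^α Ω)(z̄) q_l(z̄) = 0 for all α ∈ ℤ_{≥0}^m are equivalent to the finitely many conditions indexed by γ ∈ Γ. -/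

import Mathlib

open Matrix

/-- Partial derivative `∂_i` of a scalar function on `ℝ^m`. -/
noncomputable def pd {m : ℕ} (i : Fin m) (f : (Fin m → ℝ) → ℝ) : (Fin m → ℝ) → ℝ :=
  fun z => fderiv ℝ f z (Pi.single i 1)

/-- Iterated partial derivative `∂^α = ∂₁^{α₁} ⋯ ∂_m^{α_m}` for a multi-index `α`. -/
noncomputable def pdMulti {m : ℕ} (α : Fin m → ℕ) (f : (Fin m → ℝ) → ℝ) :
    (Fin m → ℝ) → ℝ :=
  ((List.finRange m).foldr (fun i F => (pd i)^[α i] ∘ F) id) f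

/-- Entrywise partial derivative `∂_i` of a matrix-valued function on `ℝ^m`. -/
noncomputable def pdM {m d : ℕ} (i : Fin m) (M : (Fin m → ℝ) → Matrix (Fin d) (Fin d) ℝ) :
    (Fin m → ℝ) → Matrix (Fin d) (Fin d) ℝ :=
  fun z => Matrix.of fun k l => fderiv ℝ (fun y => M y k l) z (Pi.single i 1)

/-- The mapping `D_i Ω := A_iᵀ Ω + Ω A_i + ∂_i Ω`. -/
noncomputable def Dop {m d : ℕ} (A : Fin m → (Fin m → ℝ) → Matrix (Fin d) (Fin d) ℝ)
    (i : Fin m) (Ω : (Fin m → ℝ) → Matrix (Fin d) (Fin d) ℝ) :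
    (Fin m → ℝ) → Matrix (Fin d) (Fin d) ℝ :=
  fun z => (A i z)ᵀ * Ω z + Ω z * A i z + pdM i Ω z

/-- `𝒟^α Ω = D₁^{α₁} ∘ D₂^{α₂} ∘ ⋯ ∘ D_m^{α_m}` applied to `Ω`, for a multi-index `α`. -/
noncomputable def DopMulti {m d : ℕ} (A : Fin m → (Fin m → ℝ) → Matrix (Fin d) (Fin d) ℝ)
    (α : Fin m → ℕ) (Ω : (Fin m → ℝ) → Matrix (Fin d) (Fin d) ℝ) :
    (Fin m → ℝ) → Matrix (Fin d) (Fin d) ℝ :=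
  ((List.finRange m).foldr (fun i F => (Dop A i)^[α i] ∘ F) id) Ω

/-- A property preserved by every `Dop A i` passes from `Ω` to `DopMulti A α Ω`. -/
theorem DopMulti_induction {m d : ℕ} {A : Fin m → (Fin m → ℝ) → Matrix (Fin d) (Fin d) ℝ}
    {P : ((Fin m → ℝ) → Matrix (Fin d) (Fin d) ℝ) → Prop}
    (step : ∀ i M, P M → P (Dop A i M)) (α : Fin m → ℕ)
    {Ω : (Fin m → ℝ) → Matrix (Fin d) (Fin d) ℝ} (base : P Ω) : P (DopMulti A α Ω) := by
  have iter : ∀ (i : Fin m) (n : ℕ) M, P M → P ((Dop A i)^[n] M) := by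
    intro i n
    induction n with
    | zero => intro M hM; exact hM
    | succ n ih =>
      intro M hM
      rw [Function.iterate_succ_apply]
      exact ih _ (step i M hM)
  unfold DopMulti
  induction List.finRange m with
  | nil => exact base
  | cons i L ih => exact iter i _ _ ih

theorem DopMulti_zero {m d : ℕ} (A : Fin m → (Fin m → ℝ) → Matrix (Fin d) (Fin d) ℝ)
    (Ω : (Fin m → ℝ) → Matrix (Fin d) (Fin d) ℝ) : DopMulti A 0 Ω = Ω := by
  unfold DopMulti
  induction List.finRange m with
  | nil => rfl
  | cons i L ih => exact ih

theorem contDiffOn_Dop {m d : ℕ} {U : Set (Fin m → ℝ)} (hU : IsOpen U)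
    {A : Fin m → (Fin m → ℝ) → Matrix (Fin d) (Fin d) ℝ}
    (hA : ∀ i k l, ContDiffOn ℝ (⊤ : ℕ∞) (fun z => A i z k l) U) (i : Fin m)
    {M : (Fin m → ℝ) → Matrix (Fin d) (Fin d) ℝ}
    (hM : ∀ k l, ContDiffOn ℝ (⊤ : ℕ∞) (fun z => M z k l) U) (k l : Fin d) :
    ContDiffOn ℝ (⊤ : ℕ∞) (fun z => Dop A i M z k l) U := by
  have hd : ContDiffOn ℝ (⊤ : ℕ∞)
      (fun z => fderiv ℝ (fun y => M y k l) z (Pi.single i 1)) U :=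
    ((hM k l).fderiv_of_isOpen hU (m := ((⊤ : ℕ∞) : WithTop ℕ∞)) (by simp)).clm_apply
      contDiffOn_const
  simp only [Dop, pdM, Matrix.add_apply, Matrix.mul_apply, Matrix.transpose_apply,
    Matrix.of_apply]
  exact ((ContDiffOn.sum fun j _ => (hA i j k).mul (hM j l)).add
    (ContDiffOn.sum fun j _ => (hM k j).mul (hA i j l))).add hd

/-- The product rule `∂_i (pᵀ M q) = pᵀ (D_i M) q` for solutions `p`, `q` of the Pfaffian
system. -/
theorem fderiv_dotProduct_mulVec_single {m d : ℕ}
    {A : Fin m → (Fin m → ℝ) → Matrix (Fin d) (Fin d) ℝ}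
    {M : (Fin m → ℝ) → Matrix (Fin d) (Fin d) ℝ} {p q : (Fin m → ℝ) → (Fin d → ℝ)}
    {z : Fin m → ℝ} {i : Fin m}
    (hM : ∀ k l, DifferentiableAt ℝ (fun y => M y k l) z)
    (hp : DifferentiableAt ℝ p z) (hq : DifferentiableAt ℝ q z)
    (hp' : fderiv ℝ p z (Pi.single i 1) = A i z *ᵥ p z)
    (hq' : fderiv ℝ q z (Pi.single i 1) = A i z *ᵥ q z) :
    fderiv ℝ (fun y => p y ⬝ᵥ (M y *ᵥ q y)) z (Pi.single i 1) =
      p z ⬝ᵥ (Dop A i M z *ᵥ q z) := by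
  have hpa := fun a => hasFDerivAt_pi'.1 hp.hasFDerivAt a
  have hqa := fun a => hasFDerivAt_pi'.1 hq.hasFDerivAt a
  have h : HasFDerivAt (fun y => ∑ a, p y a * ∑ b, M y a b * q y b) _ z :=
    HasFDerivAt.fun_sum fun a _ => (hpa a).mul
      (HasFDerivAt.fun_sum fun b (_ : b ∈ Finset.univ) => ((hM a b).hasFDerivAt).mul (hqa b))
  have hfun : (fun y => p y ⬝ᵥ (M y *ᵥ q y)) =
      fun y => ∑ a, p y a * ∑ b, M y a b * q y b := rfl
  have hA : p z ⬝ᵥ (((A i z)ᵀ * M z) *ᵥ q z) = (A i z *ᵥ p z) ⬝ᵥ (M z *ᵥ q z) := by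
    rw [← Matrix.mulVec_mulVec, Matrix.dotProduct_mulVec, Matrix.vecMul_transpose]
  rw [hfun, h.fderiv]
  simp only [Dop, Matrix.add_mulVec, dotProduct_add]
  rw [hA, ← Matrix.mulVec_mulVec, ← hp', ← hq']
  simp [dotProduct, Matrix.mulVec, pdM, Finset.sum_add_distrib, mul_comm]
  ring

theorem differentiableAt_dotProduct_mulVec {m d : ℕ}
    {M : (Fin m → ℝ) → Matrix (Fin d) (Fin d) ℝ} {p q : (Fin m → ℝ) → (Fin d → ℝ)}
    {z : Fin m → ℝ} (hM : ∀ k l, DifferentiableAt ℝ (fun y => M y k l) z)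
    (hp : DifferentiableAt ℝ p z) (hq : DifferentiableAt ℝ q z) :
    DifferentiableAt ℝ (fun y => p y ⬝ᵥ (M y *ᵥ q y)) z := by
  have hpa := differentiableAt_pi.1 hp
  have hqa := differentiableAt_pi.1 hq
  simp only [dotProduct, Matrix.mulVec]
  fun_prop

/-- If `‖Dg‖ ≤ K ‖g‖` on a convex set, then `g` vanishes there as soon as it vanishes at one
point. -/
theorem Convex.eq_zero_of_norm_fderiv_le {E F : Type*} [NormedAddCommGroup E] [NormedSpace ℝ E]
    [NormedAddCommGroup F] [NormedSpace ℝ F] {s : Set E} (hs : Convex ℝ s) {g : E → F} {K : ℝ}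
    (hg : ∀ x ∈ s, DifferentiableAt ℝ g x) (hK : ∀ x ∈ s, ‖fderiv ℝ g x‖ ≤ K * ‖g x‖)
    {x y : E} (hx : x ∈ s) (hy : y ∈ s) (h0 : g x = 0) : g y = 0 := by
  have hmem : ∀ r ∈ Set.Icc (0 : ℝ) 1, AffineMap.lineMap x y r ∈ s := fun r hr =>
    hs.lineMap_mem hx hy hr
  have hder : ∀ r ∈ Set.Icc (0 : ℝ) 1, HasDerivAt (fun r => g (AffineMap.lineMap x y r))
      (fderiv ℝ g (AffineMap.lineMap x y r) (y - x)) r := fun r hr =>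
    (hg _ (hmem r hr)).hasFDerivAt.comp_hasDerivAt r AffineMap.hasDerivAt_lineMap
  have key := norm_le_gronwallBound_of_norm_deriv_right_le (δ := 0) (K := K * ‖y - x‖) (ε := 0)
    (fun r hr => (hder r hr).continuousAt.continuousWithinAt)
    (fun r hr => (hder r (Set.Ico_subset_Icc_self hr)).hasDerivWithinAt)
    (by simp [h0])
    (fun r hr => by
      have h1 := ContinuousLinearMap.le_of_opNorm_le _
        (hK _ (hmem r (Set.Ico_subset_Icc_self hr))) (y - x)
      linarith)
    1 (by simp)
  simpa [gronwallBound_ε0_δ0] using key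

/-- Unique continuation for a linear first-order system `∂_i g_k = ∑_l c_{ikl} g_l` with
continuous coefficients on a connected open set. -/
theorem eq_zero_of_fderiv_single_eq_sum {m t : ℕ} {U : Set (Fin m → ℝ)} (hU : IsOpen U)
    (hUconn : IsPreconnected U) {c : Fin m → Fin t → Fin t → (Fin m → ℝ) → ℝ}
    (hc : ∀ i k l, ContinuousOn (c i k l) U) {g : (Fin m → ℝ) → (Fin t → ℝ)}
    (hg : ∀ z ∈ U, DifferentiableAt ℝ g z)
    (hg' : ∀ z ∈ U, ∀ i k, fderiv ℝ g z (Pi.single i 1) k = ∑ l, c i k l z * g z l)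
    {w : Fin m → ℝ} (hw : w ∈ U) (h0 : g w = 0) : ∀ z ∈ U, g z = 0 := by
  set S : (Fin m → ℝ) → ℝ := fun z => ∑ i, ∑ k, ∑ l, |c i k l z|
  have hScont : ContinuousOn S U :=
    continuousOn_finsetSum _ fun i _ => continuousOn_finsetSum _ fun k _ =>
      continuousOn_finsetSum _ fun l _ => (hc i k l).abs
  have hbound : ∀ z ∈ U, ‖fderiv ℝ g z‖ ≤ S z * ‖g z‖ := by
    intro z hz
    have hS0 : 0 ≤ S z := by positivity
    refine ContinuousLinearMap.opNorm_le_bound _ (by positivity) fun v => ?_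
    refine (pi_norm_le_iff_of_nonneg (by positivity)).2 fun k => ?_
    have hv : v = ∑ i, v i • (Pi.single i (1 : ℝ) : Fin m → ℝ) := pi_eq_sum_univ' v
    have hexp : fderiv ℝ g z v k = ∑ i, v i * ∑ l, c i k l z * g z l := by
      conv_lhs => rw [hv]
      simp [map_sum, Finset.sum_apply, hg' z hz]
    rw [hexp, Real.norm_eq_abs]
    calc |∑ i, v i * ∑ l, c i k l z * g z l|
        ≤ ∑ i, |v i * ∑ l, c i k l z * g z l| := Finset.abs_sum_le_sum_abs _ _
      _ ≤ ∑ i, ‖v‖ * ∑ l, |c i k l z| * ‖g z‖ := by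
          refine Finset.sum_le_sum fun i _ => ?_
          rw [abs_mul]
          refine mul_le_mul (norm_le_pi_norm v i) ?_ (abs_nonneg _) (norm_nonneg _)
          refine (Finset.abs_sum_le_sum_abs _ _).trans (Finset.sum_le_sum fun l _ => ?_)
          rw [abs_mul]
          exact mul_le_mul_of_nonneg_left (norm_le_pi_norm (g z) l) (abs_nonneg _)
      _ = (∑ i, ∑ l, |c i k l z|) * ‖g z‖ * ‖v‖ := by
          simp only [← Finset.sum_mul, ← Finset.mul_sum]
          ring
      _ ≤ S z * ‖g z‖ * ‖v‖ := by
          gcongr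
          refine Finset.sum_le_sum fun i _ => ?_
          exact Finset.single_le_sum (f := fun k => ∑ l, |c i k l z|)
            (fun k _ => by positivity) (Finset.mem_univ k)
  have hopen : IsOpen {z | z ∈ U ∧ g z = 0} := by
    refine Metric.isOpen_iff.2 fun z ⟨hz, hgz⟩ => ?_
    have hnhds : ∀ᶠ y in nhds z, y ∈ U ∧ S y < S z + 1 :=
      (hU.eventually_mem hz).and
        ((hScont.continuousAt (hU.mem_nhds hz)).eventually_lt continuousAt_const (by linarith))
    obtain ⟨r, hr, hball⟩ := Metric.eventually_nhds_iff_ball.1 hnhds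
    refine ⟨r, hr, fun y hy => ⟨(hball y hy).1, ?_⟩⟩
    exact (convex_ball z r).eq_zero_of_norm_fderiv_le (K := S z + 1)
      (fun x hx => hg x (hball x hx).1)
      (fun x hx => (hbound x (hball x hx).1).trans
        (mul_le_mul_of_nonneg_right (hball x hx).2.le (norm_nonneg _)))
      (Metric.mem_ball_self hr) hy hgz
  have hsub : U ⊆ {z | z ∈ U ∧ g z = 0} := by
    refine hUconn.subset_of_closure_inter_subset hopen ⟨w, hw, hw, h0⟩ ?_
    rintro z ⟨hzc, hzU⟩
    refine ⟨hzU, ?_⟩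
    by_contra hne
    have hev : ∀ᶠ y in nhds z, g y ≠ 0 := (hg z hzU).continuousAt.eventually_ne hne
    obtain ⟨y, hy, hy'⟩ := (mem_closure_iff_frequently.1 hzc).and_eventually hev |>.exists
    exact hy' hy.2
  exact fun z hz => (hsub hz).2

/-- Theorem 2 of the paper: on an open connected `U`, given the recursion
`D_i (𝒟^{γ_k} Ω) = Σ_l c_{ikl} 𝒟^{γ_l} Ω` with continuous coefficients `c_{ikl}`
and `γ₀ = 0`, for smooth solutions `q_k, q_l` of the Pfaffian system the function
`q_kᵀ Ω q_l` vanishes identically on `U` iff the finitely many conditions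
`q_k(zbar)ᵀ (𝒟^γ Ω)(zbar) q_l(zbar) = 0`, `γ ∈ Γ`, hold; in particular the
infinitely many conditions indexed by all multi-indices `α` are equivalent to the
finitely many conditions indexed by `Γ`. -/
theorem stmt15 {m d t : ℕ} [NeZero t]
    (U : Set (Fin m → ℝ)) (hU : IsOpen U) (hUconn : IsConnected U)
    (A : Fin m → (Fin m → ℝ) → Matrix (Fin d) (Fin d) ℝ)
    (Ω : (Fin m → ℝ) → Matrix (Fin d) (Fin d) ℝ)
    (hA : ∀ i k l, ContDiffOn ℝ (⊤ : ℕ∞) (fun z => A i z k l) U)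
    (hΩ : ∀ k l, ContDiffOn ℝ (⊤ : ℕ∞) (fun z => Ω z k l) U)
    (γ : Fin t → (Fin m → ℕ)) (hγ0 : γ 0 = 0)
    (c : Fin m → Fin t → Fin t → (Fin m → ℝ) → ℝ)
    (hccont : ∀ i k l, ContinuousOn (c i k l) U)
    (hc : ∀ i k, ∀ z ∈ U,
      Dop A i (DopMulti A (γ k) Ω) z = ∑ l, c i k l z • DopMulti A (γ l) Ω z)
    (qk ql : (Fin m → ℝ) → (Fin d → ℝ))
    (hqk : ContDiffOn ℝ (⊤ : ℕ∞) qk U) (hql : ContDiffOn ℝ (⊤ : ℕ∞) ql U)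
    (hqk' : ∀ z ∈ U, ∀ i, fderiv ℝ qk z (Pi.single i 1) = A i z *ᵥ qk z)
    (hql' : ∀ z ∈ U, ∀ i, fderiv ℝ ql z (Pi.single i 1) = A i z *ᵥ ql z)
    (zbar : Fin m → ℝ) (hzbar : zbar ∈ U) :
    ((∀ z ∈ U, qk z ⬝ᵥ (Ω z *ᵥ ql z) = 0) ↔
      (∀ k : Fin t, qk zbar ⬝ᵥ (DopMulti A (γ k) Ω zbar *ᵥ ql zbar) = 0)) ∧
    ((∀ α : Fin m → ℕ, qk zbar ⬝ᵥ (DopMulti A α Ω zbar *ᵥ ql zbar) = 0) ↔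
      (∀ k : Fin t, qk zbar ⬝ᵥ (DopMulti A (γ k) Ω zbar *ᵥ ql zbar) = 0)) := by
  have diff {F : Type} [NormedAddCommGroup F] [NormedSpace ℝ F] {f : (Fin m → ℝ) → F}
      (hf : ContDiffOn ℝ (⊤ : ℕ∞) f U) {z : Fin m → ℝ} (hz : z ∈ U) : DifferentiableAt ℝ f z :=
    (hf.differentiableOn (by simp)).differentiableAt (hU.mem_nhds hz)
  have hsmooth : ∀ α k l, ContDiffOn ℝ (⊤ : ℕ∞) (fun z => DopMulti A α Ω z k l) U := fun α =>
    DopMulti_induction (P := fun M => ∀ k l, ContDiffOn ℝ (⊤ : ℕ∞) (fun z => M z k l) U)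
      (fun i _ hM => contDiffOn_Dop hU hA i hM) α hΩ
  have hall : (∀ z ∈ U, qk z ⬝ᵥ (Ω z *ᵥ ql z) = 0) →
      ∀ α : Fin m → ℕ, qk zbar ⬝ᵥ (DopMulti A α Ω zbar *ᵥ ql zbar) = 0 := by
    intro h α
    refine (DopMulti_induction (A := A)
      (P := fun M => (∀ k l, ContDiffOn ℝ (⊤ : ℕ∞) (fun z => M z k l) U) ∧
        ∀ z ∈ U, qk z ⬝ᵥ (M z *ᵥ ql z) = 0) ?_ α ⟨hΩ, h⟩).2 zbar hzbar
    rintro i M ⟨hM, hM0⟩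
    refine ⟨contDiffOn_Dop hU hA i hM, fun z hz => ?_⟩
    rw [← fderiv_dotProduct_mulVec_single (fun k l => diff (hM k l) hz) (diff hqk hz)
      (diff hql hz) (hqk' z hz i) (hql' z hz i)]
    have hev : (fun y => qk y ⬝ᵥ (M y *ᵥ ql y)) =ᶠ[nhds z] fun _ => 0 :=
      (hU.eventually_mem hz).mono hM0
    simp [hev.fderiv_eq]
  have hback : (∀ k : Fin t, qk zbar ⬝ᵥ (DopMulti A (γ k) Ω zbar *ᵥ ql zbar) = 0) →
      ∀ z ∈ U, qk z ⬝ᵥ (Ω z *ᵥ ql z) = 0 := by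
    intro h z hz
    have hdiff : ∀ z ∈ U, ∀ k : Fin t, DifferentiableAt ℝ
        (fun y => qk y ⬝ᵥ (DopMulti A (γ k) Ω y *ᵥ ql y)) z := fun z hz k =>
      differentiableAt_dotProduct_mulVec (fun a b => diff (hsmooth (γ k) a b) hz)
        (diff hqk hz) (diff hql hz)
    have hzero := eq_zero_of_fderiv_single_eq_sum hU hUconn.isPreconnected hccont
      (g := fun y k => qk y ⬝ᵥ (DopMulti A (γ k) Ω y *ᵥ ql y))
      (fun z hz => differentiableAt_pi.2 (hdiff z hz))
      (fun z hz i k => by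
        rw [fderiv_pi (hdiff z hz), ContinuousLinearMap.pi_apply,
          fderiv_dotProduct_mulVec_single (fun a b => diff (hsmooth (γ k) a b) hz)
            (diff hqk hz) (diff hql hz) (hqk' z hz i) (hql' z hz i), hc i k z hz]
        simp only [Matrix.sum_mulVec, dotProduct_sum, Matrix.smul_mulVec, dotProduct_smul,
          smul_eq_mul])
      hzbar (funext h) z hz
    simpa [hγ0, DopMulti_zero] using congrFun hzero 0
  exact ⟨⟨fun h k => hall h (γ k), hback⟩, ⟨fun h k => h (γ k), fun h => hall (hback h)⟩⟩
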